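/- arXiv:2502.00362 — 3 statements merged into one kernel-verified Lean document; each statement's English description precedes it below -/
import Mathlib

section
/- Let G = (V, E) be a query graph with n = |V| ≥ 2 vertices that admits at least one valid edge sequence (for instance, any connected query graph). Then the minimum of the total cost Σ_{k=0}^{n−2} κ_k over all valid edge sequences of G equals the minimum of the cost C(T) over all left-deep join trees T whose leaves are exactly the vertices of G and that adhere to G. (This common value is the cost computed by the dynamic programming algorithm for join ordering without cross-products, and the left-hand minimum is the minimum of the paper's cost HUBO over assignments satisfying the validity constraints.) -/
open Finset

/-- A binary join tree with leaves labeled by relations in `V`. -/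
inductive JoinTree (V : Type*) where
  | leaf (v : V) : JoinTree V
  | node (l r : JoinTree V) : JoinTree V

namespace JoinTree

variable {V : Type*} [DecidableEq V]

/-- The list of leaf labels of a join tree (left to right). -/
def leafList : JoinTree V → List V
  | leaf v => [v]
  | node l r => l.leafList ++ r.leafList

/-- The finite set of leaf labels of a join tree. -/
def leaves : JoinTree V → Finset V
  | leaf v => {v}
  | node l r => l.leaves ∪ r.leaves

/-- The (estimated) cardinality of the join result of a join tree. -/
def card (c : V → ℝ) (f : Sym2 V → ℝ) : JoinTree V → ℝ
  | leaf v => c v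
  | node l r =>
      (∏ i ∈ l.leaves, ∏ j ∈ r.leaves, f s(i, j)) * card c f l * card c f r

/-- The cost of a join tree: sum of the cardinalities of all intermediate results. -/
def cost (c : V → ℝ) (f : Sym2 V → ℝ) : JoinTree V → ℝ
  | leaf _ => 0
  | node l r => card c f (node l r) + cost c f l + cost c f r

/-- A join tree is left-deep if the right child of every internal node is a leaf. -/
def IsLeftDeep : JoinTree V → Prop
  | leaf _ => True
  | node l (leaf _) => IsLeftDeep l
  | node _ (node _ _) => False

/-- A join tree adheres to the query graph `G` if every internal node joins two
subtrees connected by an edge of `G`. -/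
def Adheres (G : SimpleGraph V) : JoinTree V → Prop
  | leaf _ => True
  | node l r =>
      (∃ i ∈ l.leaves, ∃ j ∈ r.leaves, G.Adj i j) ∧ Adheres G l ∧ Adheres G r

/-- The left-deep join tree with leaf labels `v 0, …, v k` from deepest to shallowest. -/
def leftDeep (v : ℕ → V) : ℕ → JoinTree V
  | 0 => leaf (v 0)
  | k + 1 => node (leftDeep v k) (leaf (v (k + 1)))

end JoinTree

section EdgeSeq

variable {V : Type*} [DecidableEq V]

/-- The product of the selectivities over all unordered pairs of distinct vertices of `s`. -/
def pairProd (f : Sym2 V → ℝ) (s : Finset V) : ℝ :=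
  ∏ p ∈ s.sym2 with ¬ p.IsDiag, f p

/-- `∏_{i ∈ s} c(i) · ∏_{{i,j} ⊆ s} f(i,j)`: the cardinality of the join of the relations in `s`. -/
def vertexProd (c : V → ℝ) (f : Sym2 V → ℝ) (s : Finset V) : ℝ :=
  (∏ i ∈ s, c i) * pairProd f s

/-- `U k`: the union of the endpoint sets of the edges `e 0, …, e k`. -/
def endpointSet (e : ℕ → V × V) (k : ℕ) : Finset V :=
  (Finset.range (k + 1)).biUnion fun i => {(e i).1, (e i).2}

/-- A valid edge sequence of length `n - 1` for a query graph `G` on `n` vertices. -/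
def ValidEdgeSeq (G : SimpleGraph V) (n : ℕ) (e : ℕ → V × V) : Prop :=
  (∀ k ≤ n - 2, G.Adj (e k).1 (e k).2) ∧
  (∀ k ≤ n - 2, (endpointSet e k).card = k + 2)

/-- The total cost `Σ_{k=0}^{n-2} κ_k` of an edge sequence. -/
def seqCost (c : V → ℝ) (f : Sym2 V → ℝ) (n : ℕ) (e : ℕ → V × V) : ℝ :=
  ∑ k ∈ Finset.range (n - 1), vertexProd c f (endpointSet e k)

end EdgeSeq

namespace JoinTree

variable {V : Type*} [DecidableEq V]

theorem mem_leafList_iff_mem_leaves (T : JoinTree V) (v : V) : v ∈ T.leafList ↔ v ∈ T.leaves := by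
  induction T with
  | leaf w => simp [leafList, leaves]
  | node l r ihl ihr => simp [leafList, leaves, ihl, ihr]

theorem nodup_leafList_node_leaf (l : JoinTree V) (v : V) :
    (node l (leaf v)).leafList.Nodup ↔ l.leafList.Nodup ∧ v ∉ l.leaves := by
  simp only [leafList, List.nodup_append, ← mem_leafList_iff_mem_leaves]
  constructor
  · rintro ⟨h, -, h'⟩
    exact ⟨h, fun hv => h' v hv v (by simp) rfl⟩
  · rintro ⟨h, h'⟩
    refine ⟨h, by simp, ?_⟩
    rintro a ha b hb rfl
    exact h' (by simpa [List.mem_singleton.1 hb] using ha)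

theorem leaves_node_leaf (l : JoinTree V) (v : V) :
    (node l (leaf v)).leaves = insert v l.leaves := by
  simp [leaves]

end JoinTree

section EdgeSeq

variable {V : Type*} [DecidableEq V]

theorem pairProd_insert (f : Sym2 V → ℝ) {s : Finset V} {v : V} (hv : v ∉ s) :
    pairProd f (insert v s) = (∏ i ∈ s, f s(i, v)) * pairProd f s := by
  have h : ((insert v s).sym2.filter fun p => ¬ p.IsDiag) =
      s.image (fun i => s(i, v)) ∪ s.sym2.filter fun p => ¬ p.IsDiag := by
    ext p
    induction p using Sym2.ind with
    | _ x y =>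
      simp only [mem_filter, mk_mem_sym2_iff, mem_insert, Sym2.mk_isDiag_iff, mem_union,
        mem_image, Sym2.eq_iff]
      grind
  unfold pairProd
  rw [h, prod_union, prod_image]
  · intro a _ b _ hab
    exact Sym2.congr_left.1 hab
  · rw [disjoint_left]
    rintro p hp hp'
    obtain ⟨i, -, rfl⟩ := mem_image.1 hp
    exact hv (mk_mem_sym2_iff.1 (mem_filter.1 hp').1).2

theorem vertexProd_insert (c : V → ℝ) (f : Sym2 V → ℝ) {s : Finset V} {v : V} (hv : v ∉ s) :
    vertexProd c f (insert v s) = (∏ i ∈ s, f s(i, v)) * vertexProd c f s * c v := by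
  rw [vertexProd, vertexProd, prod_insert hv, pairProd_insert f hv]
  ring

theorem vertexProd_singleton (c : V → ℝ) (f : Sym2 V → ℝ) (v : V) :
    vertexProd c f {v} = c v := by
  rw [← insert_empty_eq, vertexProd_insert c f (notMem_empty v)]
  simp [vertexProd, pairProd]

theorem endpointSet_zero (e : ℕ → V × V) : endpointSet e 0 = {(e 0).1, (e 0).2} := by
  simp [endpointSet]

theorem endpointSet_succ (e : ℕ → V × V) (k : ℕ) :
    endpointSet e (k + 1) = {(e (k + 1)).1, (e (k + 1)).2} ∪ endpointSet e k := by
  rw [endpointSet, range_add_one, biUnion_insert, endpointSet]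

theorem endpointSet_congr {e e' : ℕ → V × V} {k : ℕ} (h : ∀ i ≤ k, e i = e' i) :
    endpointSet e k = endpointSet e' k := by
  unfold endpointSet
  refine biUnion_congr rfl fun i hi => ?_
  rw [h i (by simpa [Nat.lt_succ_iff] using hi)]

end EdgeSeq

namespace JoinTree

variable {V : Type*} [DecidableEq V]

theorem IsLeftDeep.card_eq_vertexProd (c : V → ℝ) (f : Sym2 V → ℝ) {T : JoinTree V}
    (hT : T.IsLeftDeep) (hnd : T.leafList.Nodup) : T.card c f = vertexProd c f T.leaves := by
  induction T with
  | leaf v => simp [card, leaves, vertexProd_singleton]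
  | node l r ihl _ =>
    cases r with
    | node => exact hT.elim
    | leaf v =>
      obtain ⟨hl, hv⟩ := (nodup_leafList_node_leaf l v).1 hnd
      rw [leaves_node_leaf, vertexProd_insert c f hv, ← ihl hT hl]
      simp [card, leaves]

theorem cost_node_leaf (c : V → ℝ) (f : Sym2 V → ℝ) {l : JoinTree V} {v : V}
    (hT : l.IsLeftDeep) (hnd : (node l (leaf v)).leafList.Nodup) :
    (node l (leaf v)).cost c f = vertexProd c f (insert v l.leaves) + l.cost c f := by
  have hld : (node l (leaf v)).IsLeftDeep := hT
  rw [cost, hld.card_eq_vertexProd c f hnd, leaves_node_leaf, cost, add_zero]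

theorem exists_isLeftDeep_of_edgeSeq (G : SimpleGraph V) (c : V → ℝ) (f : Sym2 V → ℝ)
    (e : ℕ → V × V) (k : ℕ) (hadj : ∀ j ≤ k, G.Adj (e j).1 (e j).2)
    (hcard : ∀ j ≤ k, (endpointSet e j).card = j + 2) :
    ∃ T : JoinTree V, T.leafList.Nodup ∧ T.leaves = endpointSet e k ∧ T.IsLeftDeep ∧
      T.Adheres G ∧ T.cost c f = ∑ j ∈ range (k + 1), vertexProd c f (endpointSet e j) := by
  induction k with
  | zero =>
    have h0 := hadj 0 le_rfl
    have hnd : (node (leaf (e 0).1) (leaf (e 0).2)).leafList.Nodup := by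
      simp [leafList, h0.ne]
    refine ⟨node (leaf (e 0).1) (leaf (e 0).2), hnd, ?_, trivial, ?_, ?_⟩
    · simp [leaves, endpointSet_zero]
    · simpa [Adheres, leaves] using h0
    · rw [cost_node_leaf c f (l := leaf (e 0).1) trivial hnd]
      simp [leaves, cost, endpointSet_zero, pair_comm]
  | succ k ih =>
    obtain ⟨T, hnd, hleaves, hld, hadh, hcost⟩ :=
      ih (fun j hj => hadj j (by omega)) (fun j hj => hcard j (by omega))
    obtain ⟨u, v, hu, hv, huv, hins⟩ : ∃ u v, u ∈ endpointSet e k ∧ v ∉ endpointSet e k ∧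
        G.Adj u v ∧ endpointSet e (k + 1) = insert v (endpointSet e k) := by
      have ha := hadj (k + 1) le_rfl
      have h1 := hcard k (by omega)
      have h2 := hcard (k + 1) le_rfl
      have hsucc := endpointSet_succ e k
      rw [insert_union, singleton_union] at hsucc
      by_cases hx : (e (k + 1)).1 ∈ endpointSet e k
      · rw [insert_eq_of_mem (mem_insert_of_mem hx)] at hsucc
        refine ⟨_, _, hx, fun hy => ?_, ha, hsucc⟩
        rw [hsucc, insert_eq_of_mem hy] at h2
        omega
      · by_cases hy : (e (k + 1)).2 ∈ endpointSet e k
        · rw [insert_eq_of_mem hy] at hsucc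
          exact ⟨_, _, hy, hx, ha.symm, hsucc⟩
        · rw [hsucc, card_insert_of_notMem (by simp [hx, ha.ne]), card_insert_of_notMem hy] at h2
          omega
    have hnd' : (node T (leaf v)).leafList.Nodup :=
      (nodup_leafList_node_leaf T v).2 ⟨hnd, hleaves ▸ hv⟩
    refine ⟨node T (leaf v), hnd', by rw [leaves_node_leaf, hleaves, hins], hld,
      ⟨⟨u, hleaves ▸ hu, v, by simp [leaves], huv⟩, hadh, trivial⟩, ?_⟩
    rw [cost_node_leaf c f hld hnd', hleaves, ← hins, hcost, sum_range_succ _ (k + 1), add_comm]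

theorem exists_edgeSeq_of_isLeftDeep (G : SimpleGraph V) (c : V → ℝ) (f : Sym2 V → ℝ)
    (T : JoinTree V) (hnd : T.leafList.Nodup) (hld : T.IsLeftDeep) (hadh : T.Adheres G)
    (k : ℕ) (hk : T.leaves.card = k + 2) :
    ∃ e : ℕ → V × V, (∀ j ≤ k, G.Adj (e j).1 (e j).2) ∧
      (∀ j ≤ k, (endpointSet e j).card = j + 2) ∧ endpointSet e k = T.leaves ∧
      T.cost c f = ∑ j ∈ range (k + 1), vertexProd c f (endpointSet e j) := by
  induction T generalizing k with
  | leaf v => simp [leaves] at hk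
  | node l r ihl _ =>
    cases r with
    | node => exact hld.elim
    | leaf v =>
      obtain ⟨hl, hv⟩ := (nodup_leafList_node_leaf l v).1 hnd
      obtain ⟨⟨i, hi, j, hj, hij⟩, hadhl, -⟩ := hadh
      obtain rfl : j = v := by simpa [leaves] using hj
      rw [cost_node_leaf c f (l := l) hld hnd]
      rw [leaves_node_leaf] at hk ⊢
      rw [card_insert_of_notMem hv] at hk
      cases k with
      | zero =>
        obtain ⟨a, ha⟩ := card_eq_one.1 (by omega : l.leaves.card = 1)
        obtain rfl : i = a := by simpa [ha] using hi
        have hcost : l.cost c f = 0 := by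
          cases l with
          | leaf => rfl
          | node l₁ r₁ =>
            cases r₁ with
            | node => exact (hld : False).elim
            | leaf w =>
              obtain ⟨-, hw⟩ := (nodup_leafList_node_leaf l₁ w).1 hl
              obtain ⟨⟨x, hx, -⟩, -⟩ := hadhl
              rw [leaves_node_leaf, card_insert_of_notMem hw] at hk
              have := card_pos.2 ⟨x, hx⟩
              omega
        refine ⟨fun _ => (i, j), fun _ _ => hij, fun m hm => ?_, ?_, ?_⟩
        · obtain rfl : m = 0 := by omega
          rw [endpointSet_zero, card_pair hij.ne]
        · rw [endpointSet_zero, ha, pair_comm]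
        · simp [endpointSet_zero, ha, pair_comm, hcost]
      | succ k =>
        obtain ⟨e, hadj, hcard, hend, hcost⟩ := ihl hl hld hadhl k (by omega)
        let e' : ℕ → V × V := fun m => if m ≤ k then e m else (i, j)
        have he' : ∀ m ≤ k, endpointSet e' m = endpointSet e m := fun m hm =>
          endpointSet_congr fun a ha => if_pos (ha.trans hm)
        have hlast : e' (k + 1) = (i, j) := if_neg (by omega)
        have hsucc : endpointSet e' (k + 1) = insert j l.leaves := by
          rw [endpointSet_succ, hlast, he' k le_rfl, hend, insert_union, singleton_union,
            insert_eq_of_mem (mem_insert_of_mem hi)]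
        refine ⟨e', fun m hm => ?_, fun m hm => ?_, hsucc, ?_⟩
        · rcases Nat.le_succ_iff.1 hm with hm | rfl
          · simpa [e', hm] using hadj m hm
          · rwa [hlast]
        · rcases Nat.le_succ_iff.1 hm with hm | rfl
          · rw [he' m hm, hcard m hm]
          · rw [hsucc, card_insert_of_notMem hv]
            omega
        · rw [sum_range_succ, hsucc, hcost, add_comm]
          congr 1
          exact sum_congr rfl fun m hm => by rw [he' m (by simpa [Nat.lt_succ_iff] using hm)]

end JoinTree

theorem finite_setOf_seqCost {V : Type*} [Fintype V] [DecidableEq V] (G : SimpleGraph V)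
    (c : V → ℝ) (f : Sym2 V → ℝ) (n : ℕ) :
    {x : ℝ | ∃ e : ℕ → V × V, ValidEdgeSeq G n e ∧ x = seqCost c f n e}.Finite := by
  refine (Set.finite_range fun U : Fin (n - 1) → Finset V => ∑ k, vertexProd c f (U k)).subset ?_
  rintro x ⟨e, -, rfl⟩
  exact ⟨fun k => endpointSet e k, by simp [seqCost, Finset.sum_range]⟩

/-- For a query graph `G` on `n ≥ 2` vertices admitting a valid edge
sequence, the minimum of the total cost `Σ κ_k` over all valid edge sequences equals the
minimum of the cost `C(T)` over all left-deep join trees whose leaves are exactly the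
vertices of `G` and that adhere to `G`. -/
theorem min_seqCost_eq_min_leftDeep_cost
    {V : Type*} [Fintype V] [DecidableEq V] (G : SimpleGraph V)
    (c : V → ℝ) (f : Sym2 V → ℝ)
    (hc : ∀ v, 0 < c v)
    (hf : ∀ p : Sym2 V, ¬ p.IsDiag → 0 < f p ∧ f p ≤ 1)
    (hf1 : ∀ p : Sym2 V, ¬ p.IsDiag → p ∉ G.edgeSet → f p = 1)
    (n : ℕ) (hn : n = Fintype.card V) (hn2 : 2 ≤ n)
    (hex : ∃ e : ℕ → V × V, ValidEdgeSeq G n e) :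
    ∃ m : ℝ,
      IsLeast {x : ℝ | ∃ e : ℕ → V × V, ValidEdgeSeq G n e ∧ x = seqCost c f n e} m ∧
      IsLeast {x : ℝ | ∃ T : JoinTree V, T.leafList.Nodup ∧ T.leaves = Finset.univ ∧
        T.IsLeftDeep ∧ T.Adheres G ∧ x = T.cost c f} m := by
  have hset : {x : ℝ | ∃ T : JoinTree V, T.leafList.Nodup ∧ T.leaves = Finset.univ ∧
        T.IsLeftDeep ∧ T.Adheres G ∧ x = T.cost c f} =
      {x : ℝ | ∃ e : ℕ → V × V, ValidEdgeSeq G n e ∧ x = seqCost c f n e} := by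
    have hrange : n - 2 + 1 = n - 1 := by omega
    ext x
    constructor
    · rintro ⟨T, hnd, hleaves, hld, hadh, rfl⟩
      obtain ⟨e, hadj, hcard, -, hcost⟩ :=
        JoinTree.exists_edgeSeq_of_isLeftDeep G c f T hnd hld hadh (n - 2)
          (by rw [hleaves, card_univ]; omega)
      exact ⟨e, ⟨hadj, hcard⟩, by rw [hcost, seqCost, hrange]⟩
    · rintro ⟨e, ⟨hadj, hcard⟩, rfl⟩
      obtain ⟨T, hnd, hleaves, hld, hadh, hcost⟩ :=
        JoinTree.exists_isLeftDeep_of_edgeSeq G c f e (n - 2) hadj hcard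
      refine ⟨T, hnd, ?_, hld, hadh, by rw [hcost, seqCost, hrange]⟩
      rw [hleaves, ← card_eq_iff_eq_univ, hcard _ le_rfl]
      omega
  rw [hset]
  obtain ⟨e, he⟩ := hex
  obtain ⟨m, hm⟩ := (finite_setOf_seqCost G c f n).exists_minimal ⟨_, e, he, rfl⟩
  exact ⟨m, minimal_iff_isLeast.1 hm, minimal_iff_isLeast.1 hm⟩
end

section
/- Let V be a finite set, let c : V → ℝ, and let f assign to each unordered pair {i, j} of distinct elements of V a real number symmetrically (f(i, j) = f(j, i)). Then for every join tree T whose leaves are labeled by pairwise distinct elements of V, the recursively defined cardinality satisfies the closed form |T| = ∏_{i ∈ L} c(i) · ∏_{{i,j} ⊆ L, i ≠ j} f(i, j), where L is the set of leaf labels of T and the second product ranges over unordered pairs of distinct elements of L. -/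
open Finset

theorem JoinTree.mem_leaves {V : Type*} [DecidableEq V] (T : JoinTree V) (v : V) :
    v ∈ T.leaves ↔ v ∈ T.leafList := by
  induction T with
  | leaf w => simp [leaves, leafList]
  | node l r hl hr => simp [leaves, leafList, hl, hr]

theorem pairProd_singleton {V : Type*} [DecidableEq V] (f : Sym2 V → ℝ) (v : V) :
    pairProd f {v} = 1 := by
  simp [pairProd, Finset.filter_singleton]

theorem pairProd_union {V : Type*} [DecidableEq V] (f : Sym2 V → ℝ) {s t : Finset V}
    (hst : Disjoint s t) :
    pairProd f (s ∪ t) = (∏ i ∈ s, ∏ j ∈ t, f s(i, j)) * pairProd f s * pairProd f t := by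
  have hne : ∀ x ∈ s, x ∉ t := fun x hs ht => Finset.disjoint_left.1 hst hs ht
  have hcover : ((s ∪ t).sym2.filter fun p => ¬ p.IsDiag) =
      ((s ×ˢ t).image fun p => s(p.1, p.2)) ∪
        ((s.sym2.filter fun p => ¬ p.IsDiag) ∪ (t.sym2.filter fun p => ¬ p.IsDiag)) := by
    ext p
    induction p using Sym2.ind with
    | _ x y =>
      simp only [Finset.mem_filter, Finset.mk_mem_sym2_iff, Finset.mem_union, Finset.mem_image,
        Finset.mem_product, Prod.exists, Sym2.mk_isDiag_iff, Sym2.eq_iff]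
      constructor
      · rintro ⟨⟨hx | hx, hy | hy⟩, hxy⟩
        · exact Or.inr (Or.inl ⟨⟨hx, hy⟩, hxy⟩)
        · exact Or.inl ⟨x, y, ⟨hx, hy⟩, Or.inl ⟨rfl, rfl⟩⟩
        · exact Or.inl ⟨y, x, ⟨hy, hx⟩, Or.inr ⟨rfl, rfl⟩⟩
        · exact Or.inr (Or.inr ⟨⟨hx, hy⟩, hxy⟩)
      · rintro (⟨a, b, ⟨ha, hb⟩, ⟨rfl, rfl⟩ | ⟨rfl, rfl⟩⟩ | ⟨⟨hx, hy⟩, hxy⟩ | ⟨⟨hx, hy⟩, hxy⟩)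
        · exact ⟨⟨Or.inl ha, Or.inr hb⟩, fun h => hne _ ha (h ▸ hb)⟩
        · exact ⟨⟨Or.inr hb, Or.inl ha⟩, fun h => hne _ ha (h ▸ hb)⟩
        · exact ⟨⟨Or.inl hx, Or.inl hy⟩, hxy⟩
        · exact ⟨⟨Or.inr hx, Or.inr hy⟩, hxy⟩
  have hinner : Disjoint (s.sym2.filter fun p => ¬ p.IsDiag)
      (t.sym2.filter fun p => ¬ p.IsDiag) := by
    rw [Finset.disjoint_left]
    intro p
    induction p using Sym2.ind with
    | _ x y =>
      simp only [Finset.mem_filter, Finset.mk_mem_sym2_iff]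
      exact fun h h' => hne x h.1.1 h'.1.1
  have houter : Disjoint ((s ×ˢ t).image fun p => s(p.1, p.2))
      ((s.sym2.filter fun p => ¬ p.IsDiag) ∪ (t.sym2.filter fun p => ¬ p.IsDiag)) := by
    rw [Finset.disjoint_left]
    intro p hp
    obtain ⟨⟨a, b⟩, hab, rfl⟩ := Finset.mem_image.1 hp
    obtain ⟨ha, hb⟩ := Finset.mem_product.1 hab
    simp only [Finset.mem_union, Finset.mem_filter, Finset.mk_mem_sym2_iff]
    rintro (h | h)
    · exact hne b h.1.2 hb
    · exact hne a ha h.1.1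
  have hinj : Set.InjOn (fun p : V × V => s(p.1, p.2)) (s ×ˢ t : Finset (V × V)) := by
    rintro ⟨a, b⟩ hab ⟨a', b'⟩ hab' h
    obtain ⟨ha, hb⟩ := Finset.mem_product.1 (Finset.mem_coe.1 hab)
    obtain ⟨ha', hb'⟩ := Finset.mem_product.1 (Finset.mem_coe.1 hab')
    rcases Sym2.eq_iff.1 h with ⟨h₁, h₂⟩ | ⟨h₁, -⟩
    · exact Prod.ext h₁ h₂
    · exact absurd hb' (h₁ ▸ hne a ha)
  unfold pairProd
  rw [hcover, Finset.prod_union houter, Finset.prod_union hinner, Finset.prod_image hinj,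
    Finset.prod_product, mul_assoc]

/-- For every join tree `T` with pairwise distinct leaf labels, the
recursively defined cardinality has the closed form
`|T| = ∏_{i ∈ L} c(i) · ∏_{{i,j} ⊆ L} f(i, j)` where `L` is the set of leaf labels. -/
theorem joinTree_card_closed_form
    {V : Type*} [Fintype V] [DecidableEq V]
    (c : V → ℝ) (f : Sym2 V → ℝ)
    (T : JoinTree V) (hnodup : T.leafList.Nodup) :
    T.card c f = (∏ i ∈ T.leaves, c i) * pairProd f T.leaves := by
  induction T with
  | leaf v => simp [JoinTree.card, JoinTree.leaves, pairProd_singleton]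
  | node l r hl hr =>
    obtain ⟨hnl, hnr, hlr⟩ := List.nodup_append'.1 hnodup
    have hdisj : Disjoint l.leaves r.leaves := Finset.disjoint_left.2 fun x hx hy =>
      hlr ((l.mem_leaves x).1 hx) ((r.mem_leaves x).1 hy)
    rw [JoinTree.card, JoinTree.leaves, hl hnl, hr hnr, pairProd_union f hdisj,
      Finset.prod_union hdisj]
    ring
end

section
/- Let x, y, z ∈ {0, 1} ⊆ ℝ, let M > 1 be a real penalty weight, and let P : {0,1}³ → ℝ be a penalty function satisfying P(x, y, w) = 0 when w = x·y and P(x, y, w) ≥ 1 when w ≠ x·y. Then min_{w ∈ {0,1}} ( w·z + M·P(x, y, w) ) = x·y·z. -/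
/-- **HUBO-to-QUBO reduction by substitution.** For binary
`x, y, z ∈ {0, 1} ⊆ ℝ`, a penalty weight `M > 1`, and a penalty `P` vanishing exactly
when its third argument equals the product of the first two (and `≥ 1` otherwise),
the minimum over binary `w` of `w·z + M·P(x, y, w)` equals `x·y·z`. -/
theorem reduction_by_substitution
    (x y z : ℝ) (hx : x = 0 ∨ x = 1) (hy : y = 0 ∨ y = 1) (hz : z = 0 ∨ z = 1)
    (M : ℝ) (hM : 1 < M)
    (P : ℝ → ℝ → ℝ → ℝ)
    (hP0 : ∀ a b w : ℝ, (a = 0 ∨ a = 1) → (b = 0 ∨ b = 1) → (w = 0 ∨ w = 1) →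
      w = a * b → P a b w = 0)
    (hP1 : ∀ a b w : ℝ, (a = 0 ∨ a = 1) → (b = 0 ∨ b = 1) → (w = 0 ∨ w = 1) →
      w ≠ a * b → 1 ≤ P a b w) :
    IsLeast {v : ℝ | ∃ w : ℝ, (w = 0 ∨ w = 1) ∧ v = w * z + M * P x y w}
      (x * y * z) := by
  have hxy : x * y = 0 ∨ x * y = 1 := by
    rcases hx with rfl | rfl <;> simp [hy]
  refine ⟨⟨x * y, hxy, by rw [hP0 x y _ hx hy hxy rfl]; ring⟩, ?_⟩
  rintro _ ⟨w, hw, rfl⟩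
  by_cases h : w = x * y
  · rw [hP0 x y w hx hy hw h, h, mul_zero, add_zero]
  · have hP : 1 ≤ P x y w := hP1 x y w hx hy hw h
    have hMP : 1 ≤ M * P x y w := one_le_mul_of_one_le_of_one_le hM.le hP
    have hz0 : 0 ≤ z := by rcases hz with rfl | rfl <;> norm_num
    have hz1 : z ≤ 1 := by rcases hz with rfl | rfl <;> norm_num
    have hw0 : 0 ≤ w := by rcases hw with rfl | rfl <;> norm_num
    have hxy1 : x * y ≤ 1 := by rcases hxy with h | h <;> norm_num [h]
    calc x * y * z ≤ 1 := mul_le_one₀ hxy1 hz0 hz1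
      _ ≤ M * P x y w := hMP
      _ ≤ w * z + M * P x y w := le_add_of_nonneg_left (mul_nonneg hw0 hz0)
end
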